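/- Assume H1. Let X be a real random variable with density π and Z an independent standard Gaussian random variable, and let R(x) = log(1+x) − x + x²/2 for x > −1. Then lim_{d→∞} d · E[|R(ζ^d(X,Z))|] = 0. -/

import Mathlib

open MeasureTheory ProbabilityTheory Filter Real
open scoped ENNReal NNReal Topology

noncomputable section

/-- The normalized target density `π(x) = exp(-V(x)) / ∫ exp(-V(y)) dy`. -/
def piDen (V : ℝ → ℝ) (x : ℝ) : ℝ := Real.exp (-V x) / ∫ y : ℝ, Real.exp (-V y)

/-- The probability measure on `ℝ` with density `π`. -/
def piMeasure (V : ℝ → ℝ) : Measure ℝ :=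
  MeasureTheory.volume.withDensity (fun x => ENNReal.ofReal (piDen V x))

/-- `ζ^d(x,z) = exp((V(x) - V(x + ℓ d^{-1/2} z))/2) - 1`. -/
def zeta (V : ℝ → ℝ) (ℓ : ℝ) (d : ℕ) (x z : ℝ) : ℝ :=
  Real.exp ((V x - V (x + ℓ * z / Real.sqrt d)) / 2) - 1

/-- The standard normal cumulative distribution function `Φ`. -/
def stdGaussCDF (s : ℝ) : ℝ := (gaussianReal 0 1 (Set.Iic s)).toReal

/-- The remainder of the Taylor expansion of `log(1+x)`. -/
def Rlog (x : ℝ) : ℝ := Real.log (1 + x) - x + x ^ 2 / 2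

lemma exp_sub_one_sq_le (t : ℝ) : (Real.exp t - 1) ^ 2 ≤ t ^ 2 * (1 + Real.exp (2 * t)) := by
  have h1 : t + 1 ≤ Real.exp t := Real.add_one_le_exp t
  have h2 : -t + 1 ≤ Real.exp (-t) := Real.add_one_le_exp (-t)
  have h3 : Real.exp t * Real.exp (-t) = 1 := by rw [← Real.exp_add]; simp
  have h4 : Real.exp (2 * t) = Real.exp t ^ 2 := by rw [← Real.exp_nat_mul]; norm_num
  have hpos := Real.exp_pos t
  have h5 : Real.exp t - 1 ≤ t * Real.exp t := by nlinarith
  rw [h4]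
  rcases le_total 0 t with ht | ht
  · have : (Real.exp t - 1) ^ 2 ≤ (t * Real.exp t) ^ 2 := by
      apply pow_le_pow_left₀ _ h5; linarith
    nlinarith [sq_nonneg t]
  · have h6 : Real.exp t ≤ 1 := Real.exp_le_one_iff.mpr ht
    have : (1 - Real.exp t) ^ 2 ≤ (-t) ^ 2 := by
      apply pow_le_pow_left₀ <;> linarith
    nlinarith [sq_nonneg (t * Real.exp t)]

lemma Rlog_bound (u : ℝ) :
    |Rlog (Real.exp u - 1)| ≤ |u| ^ 3 + |u| ^ 3 * Real.exp (2 * u) := by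
  have hd : ∀ t : ℝ, HasDerivAt (fun t => t - (Real.exp t - 1) + (Real.exp t - 1) ^ 2 / 2)
      ((Real.exp t - 1) ^ 2) t := by
    intro t
    have he := (Real.hasDerivAt_exp t).sub_const 1
    have := ((hasDerivAt_id t).sub he).add ((he.pow 2).div_const 2)
    refine HasDerivAt.congr_deriv this ?_
    push_cast; ring
  have hR : Rlog (Real.exp u - 1) = u - (Real.exp u - 1) + (Real.exp u - 1) ^ 2 / 2 := by
    simp [Rlog]
  have key : ∀ t ∈ Set.uIcc 0 u, ‖(Real.exp t - 1) ^ 2‖ ≤ u ^ 2 * (1 + Real.exp (2 * u)) := by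
    intro t ht
    rw [Real.norm_of_nonneg (sq_nonneg _)]
    rcases le_total 0 u with hu | hu
    · rw [Set.uIcc_of_le hu] at ht
      refine (exp_sub_one_sq_le t).trans ?_
      have := ht.1
      have := ht.2
      gcongr
    · rw [Set.uIcc_of_ge hu] at ht
      have h1 : t + 1 ≤ Real.exp t := Real.add_one_le_exp t
      have h6 : Real.exp t ≤ 1 := Real.exp_le_one_iff.mpr ht.2
      have : (1 - Real.exp t) ^ 2 ≤ (-u) ^ 2 := by
        apply pow_le_pow_left₀ <;> linarith [ht.1]
      nlinarith [mul_nonneg (sq_nonneg u) (Real.exp_pos (2 * u)).le]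
  have := (convex_uIcc 0 u).norm_image_sub_le_of_norm_hasDerivWithin_le
    (fun t _ => (hd t).hasDerivWithinAt) key Set.left_mem_uIcc Set.right_mem_uIcc
  rw [hR]
  simp only [Real.norm_eq_abs, Real.exp_zero, sub_zero] at this
  norm_num at this
  calc _ ≤ _ := this
    _ = _ := by rw [← sq_abs u]; ring

lemma piZ_pos (V : ℝ → ℝ) (hVint : Integrable (fun y => Real.exp (-V y))) :
    0 < ∫ y : ℝ, Real.exp (-V y) := integral_exp_pos hVint

lemma piMeasure_prob (V : ℝ → ℝ) (hVint : Integrable (fun y => Real.exp (-V y))) :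
    IsProbabilityMeasure (piMeasure V) := by
  have hZ := piZ_pos V hVint
  constructor
  rw [piMeasure, withDensity_apply _ MeasurableSet.univ, Measure.restrict_univ]
  unfold piDen
  rw [← ofReal_integral_eq_lintegral_ofReal (hVint.div_const _)
      (ae_of_all _ fun x => div_nonneg (Real.exp_pos _).le hZ.le), integral_div, div_self hZ.ne', ENNReal.ofReal_one]

lemma piDen_meas (V : ℝ → ℝ) (hV : Measurable V) :
    Measurable (fun x => ENNReal.ofReal (piDen V x)) := by
  unfold piDen; fun_prop

lemma reversal (V : ℝ → ℝ) (hV : Measurable V)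
    (hVint : Integrable (fun y => Real.exp (-V y))) (h : ℝ) :
    ∫⁻ x, ENNReal.ofReal (|(V x - V (x + h)) / 2| ^ 3 * Real.exp (2 * ((V x - V (x + h)) / 2)))
      ∂(piMeasure V) =
    ∫⁻ x, ENNReal.ofReal (|(V x - V (x + -h)) / 2| ^ 3) ∂(piMeasure V) := by
  have hZ := piZ_pos V hVint
  rw [piMeasure, lintegral_withDensity_eq_lintegral_mul _ (piDen_meas V hV) (by fun_prop),
    lintegral_withDensity_eq_lintegral_mul _ (piDen_meas V hV) (by fun_prop)]
  refine Eq.trans ?_ (lintegral_add_right_eq_self _ h)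
  refine lintegral_congr fun x => ?_
  have hp : ∀ y, 0 ≤ piDen V y := fun y => div_nonneg (Real.exp_pos _).le hZ.le
  simp only [Pi.mul_apply]
  rw [← ENNReal.ofReal_mul (hp _), ← ENNReal.ofReal_mul (hp _)]
  congr 1
  have e1 : x + h + -h = x := by ring
  have e2 : Real.exp (-V (x + h)) = Real.exp (-V x) * Real.exp (2 * ((V x - V (x + h)) / 2)) := by
    rw [← Real.exp_add]; congr 1; ring
  have e3 : |(V (x + h) - V x) / 2| = |(V x - V (x + h)) / 2| := by
    rw [← abs_neg]; congr 1; ring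
  rw [e1, e3]
  unfold piDen
  rw [e2]; ring

/-- Third-moment bound on increments. -/
lemma incr_bound (V Vdot : ℝ → ℝ) (hV : Measurable V) (hVdot : Measurable Vdot)
    (hVint : Integrable (fun y => Real.exp (-V y)))
    (p C β : ℝ) (hp : 4 < p) (hC : 0 < C)
    (hH1i : ∀ θ : ℝ,
      Integrable (fun x => |V (x + θ) - V x - θ * Vdot x| ^ p) (piMeasure V) ∧
      (∫ x, |V (x + θ) - V x - θ * Vdot x| ^ p ∂(piMeasure V)) ^ (1 / p) ≤ C * |θ| ^ β)
    (hH1ii : Integrable (fun x => |Vdot x| ^ (6 : ℝ)) (piMeasure V)) :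
    ∃ K : ℝ, 0 ≤ K ∧ ∀ h : ℝ,
      ∫⁻ x, ENNReal.ofReal (|(V x - V (x + h)) / 2| ^ 3) ∂(piMeasure V) ≤
        ENNReal.ofReal (K * ((|h| ^ β) ^ 3 + |h| ^ 3)) := by
  have := piMeasure_prob V hVint
  set B := ∫ x, |Vdot x| ^ (6 : ℝ) ∂(piMeasure V) with hB
  have hB0 : 0 ≤ B := integral_nonneg fun x => by positivity
  refine ⟨2 * C ^ 3 + (1 + B), by positivity, fun h => ?_⟩
  rcases eq_or_ne h 0 with rfl | hh
  · simp
  set s := C * |h| ^ β with hs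
  have hs0 : 0 < s := by positivity
  obtain ⟨hi, hle⟩ := hH1i h
  set I := ∫ x, |V (x + h) - V x - h * Vdot x| ^ p ∂(piMeasure V) with hI
  have hI0 : 0 ≤ I := integral_nonneg fun x => by positivity
  have hIs : I ≤ s ^ p := by
    have := Real.rpow_le_rpow (by positivity) hle (by linarith : 0 ≤ p)
    rwa [← Real.rpow_mul hI0, one_div_mul_cancel (by linarith), Real.rpow_one] at this
  have hpt : ∀ x, |(V x - V (x + h)) / 2| ^ 3 ≤
      s ^ 3 * (1 + |V (x + h) - V x - h * Vdot x| ^ p / s ^ p)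
        + |h| ^ 3 * (1 + |Vdot x| ^ (6 : ℝ)) := by
    intro x
    set w := |V (x + h) - V x - h * Vdot x| with hw
    have hw0 : 0 ≤ w := abs_nonneg _
    have h1 : |V x - V (x + h)| ≤ w + |h| * |Vdot x| := by
      rw [← abs_mul, hw, ← abs_neg (V x - V (x + h))]
      calc _ = |(V (x + h) - V x - h * Vdot x) + h * Vdot x| := by congr 1; ring
        _ ≤ _ := abs_add_le _ _
    have h2 : w ^ 3 ≤ s ^ 3 * (1 + w ^ p / s ^ p) := by
      rw [← Real.div_rpow hw0 hs0.le]
      have e : w ^ 3 = s ^ 3 * (w / s) ^ 3 := by field_simp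
      rw [e]
      have hr : 0 ≤ w / s := by positivity
      gcongr
      clear e
      generalize w / s = r at hr ⊢
      rcases le_total r 1 with h | h
      · have := pow_le_one₀ hr h (n := 3)
        have : 0 ≤ r ^ p := by positivity
        linarith
      · have : r ^ (3 : ℝ) ≤ r ^ p := Real.rpow_le_rpow_of_exponent_le h (by linarith)
        have e3 : r ^ (3 : ℝ) = r ^ 3 := by exact_mod_cast Real.rpow_natCast r 3
        rw [e3] at this
        exact this.trans (le_add_of_nonneg_left zero_le_one)
    have h3 : (|h| * |Vdot x|) ^ 3 ≤ |h| ^ 3 * (1 + |Vdot x| ^ (6 : ℝ)) := by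
      have e6 : |Vdot x| ^ (6 : ℝ) = |Vdot x| ^ 6 := by exact_mod_cast Real.rpow_natCast |Vdot x| 6
      rw [mul_pow, e6]
      gcongr
      nlinarith [sq_nonneg (|Vdot x| ^ 3 - 1), sq_nonneg (|Vdot x| ^ 3)]
    rw [abs_div, abs_two, div_pow]
    have h4 : |V x - V (x + h)| ^ 3 ≤ (w + |h| * |Vdot x|) ^ 3 := by gcongr
    have h5 : (w + |h| * |Vdot x|) ^ 3 ≤ 4 * (w ^ 3 + (|h| * |Vdot x|) ^ 3) := by
      have := add_pow_le hw0 (by positivity : 0 ≤ |h| * |Vdot x|) 3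
      norm_num at this
      exact this
    have h6 : 0 ≤ w ^ 3 := by positivity
    have h7 : 0 ≤ (|h| * |Vdot x|) ^ 3 := by positivity
    linarith
  have hint : Integrable (fun x => s ^ 3 * (1 + |V (x + h) - V x - h * Vdot x| ^ p / s ^ p)
        + |h| ^ 3 * (1 + |Vdot x| ^ (6 : ℝ))) (piMeasure V) :=
    (((integrable_const 1).add (hi.div_const _)).const_mul _).add
      (((integrable_const 1).add hH1ii).const_mul _)
  calc _ ≤ ∫⁻ x, ENNReal.ofReal (s ^ 3 * (1 + |V (x + h) - V x - h * Vdot x| ^ p / s ^ p)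
        + |h| ^ 3 * (1 + |Vdot x| ^ (6 : ℝ))) ∂(piMeasure V) :=
        lintegral_mono fun x => ENNReal.ofReal_le_ofReal (hpt x)
    _ = ENNReal.ofReal (∫ x, (s ^ 3 * (1 + |V (x + h) - V x - h * Vdot x| ^ p / s ^ p)
        + |h| ^ 3 * (1 + |Vdot x| ^ (6 : ℝ))) ∂(piMeasure V)) :=
        (ofReal_integral_eq_lintegral_ofReal hint (ae_of_all _ fun x => by positivity)).symm
    _ = ENNReal.ofReal (s ^ 3 * (1 + I / s ^ p) + |h| ^ 3 * (1 + B)) := by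
        congr 1
        have i1 : Integrable (fun x => s ^ 3 * (1 + |V (x + h) - V x - h * Vdot x| ^ p / s ^ p))
          (piMeasure V) := ((integrable_const 1).add (hi.div_const _)).const_mul _
        have i2 : Integrable (fun x => |h| ^ 3 * (1 + |Vdot x| ^ (6 : ℝ)))
          (piMeasure V) := ((integrable_const 1).add hH1ii).const_mul _
        rw [integral_add i1 i2, integral_const_mul, integral_const_mul,
          integral_add (integrable_const 1) (hi.div_const _),
          integral_add (integrable_const 1) hH1ii, integral_div]
        simp [hI, hB]
    _ ≤ _ := by
        apply ENNReal.ofReal_le_ofReal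
        have h1 : I / s ^ p ≤ 1 := (div_le_one (by positivity)).mpr hIs
        have h2 : s ^ 3 * (1 + I / s ^ p) ≤ s ^ 3 * 2 := by gcongr; linarith
        have h3 : s ^ 3 = C ^ 3 * (|h| ^ β) ^ 3 := by rw [hs]; ring
        have h4 : 0 ≤ (1 + B) * (|h| ^ β) ^ 3 := by positivity
        have h5 : 0 ≤ C ^ 3 * |h| ^ 3 := by positivity
        rw [h3] at h2
        rw [h3]
        nlinarith

lemma gauss_moment (r : ℝ) (hr : 0 ≤ r) :
    Integrable (fun z : ℝ => |z| ^ r) (gaussianReal 0 1) := by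
  have := (memLp_id_gaussianReal (μ := 0) (v := 1) r.toNNReal).integrable_norm_rpow'
  simpa [hr] using this

/-- Lemma 6(iii): `lim_d d · E[|R(ζ^d(X,Z))|] = 0`. -/
theorem stmt_3
    (V Vdot : ℝ → ℝ) (hV : Measurable V) (hVdot : Measurable Vdot)
    (hVint : Integrable (fun y => Real.exp (-V y)))
    (p C β : ℝ) (hp : 4 < p) (hC : 0 < C) (hβ : 1 < β)
    (hH1i : ∀ θ : ℝ,
      Integrable (fun x => |V (x + θ) - V x - θ * Vdot x| ^ p) (piMeasure V) ∧
      (∫ x, |V (x + θ) - V x - θ * Vdot x| ^ p ∂(piMeasure V)) ^ (1 / p) ≤ C * |θ| ^ β)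
    (hH1ii : Integrable (fun x => |Vdot x| ^ (6 : ℝ)) (piMeasure V))
    (ℓ : ℝ) (hℓ : 0 < ℓ) :
    Tendsto (fun d : ℕ =>
      (d : ℝ) * ∫ q : ℝ × ℝ,
        |Rlog (zeta V ℓ d q.1 q.2)|
          ∂((piMeasure V).prod (gaussianReal 0 1)))
      atTop (𝓝 0) := by
  have := piMeasure_prob V hVint
  obtain ⟨K, hK, hKb⟩ := incr_bound V Vdot hV hVdot hVint p C β hp hC hH1i hH1ii
  set G : ℝ → ℝ := fun z => 2 * K * ((|ℓ * z| ^ β) ^ 3 + |ℓ * z| ^ 3) with hG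
  have hG0 : ∀ z, 0 ≤ G z := fun z => by positivity
  have hGi : Integrable G (gaussianReal 0 1) := by
    have h1 := (gauss_moment (β * 3) (by linarith)).const_mul ((ℓ ^ β) ^ 3)
    have h2 := (gauss_moment 3 (by norm_num)).const_mul (ℓ ^ 3)
    refine ((h1.add h2).const_mul (2 * K)).congr (ae_of_all _ fun z => ?_)
    have e1 : |z| ^ (β * 3) = (|z| ^ β) ^ 3 := by
      rw [Real.rpow_mul (abs_nonneg z)]
      exact_mod_cast Real.rpow_natCast (|z| ^ β) 3
    have e2 : |z| ^ (3 : ℝ) = |z| ^ 3 := by exact_mod_cast Real.rpow_natCast |z| 3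
    simp only [hG, Pi.add_apply]
    rw [abs_mul, abs_of_pos hℓ, Real.mul_rpow hℓ.le (abs_nonneg z), e1, e2]
    ring
  set M := ∫ z, G z ∂(gaussianReal 0 1) with hM
  have hM0 : 0 ≤ M := integral_nonneg hG0
  have hbound : ∀ d : ℕ, 1 ≤ d → ∫ q : ℝ × ℝ, |Rlog (zeta V ℓ d q.1 q.2)|
      ∂((piMeasure V).prod (gaussianReal 0 1)) ≤ M * ((Real.sqrt d)⁻¹) ^ 3 := by
    intro d hd
    set t := (Real.sqrt d)⁻¹ with ht
    have hd1 : (1 : ℝ) ≤ Real.sqrt d := by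
      rw [Real.one_le_sqrt]; exact_mod_cast hd
    have ht0 : 0 < t := by positivity
    have ht1 : t ≤ 1 := inv_le_one_of_one_le₀ hd1
    have hmeas : Measurable (fun q : ℝ × ℝ => |Rlog (zeta V ℓ d q.1 q.2)|) := by
      unfold Rlog zeta; fun_prop
    rw [integral_eq_lintegral_of_nonneg_ae (ae_of_all _ fun q => abs_nonneg _)
      hmeas.aestronglyMeasurable]
    apply ENNReal.toReal_le_of_le_ofReal (by positivity)
    rw [lintegral_prod_symm _ hmeas.ennreal_ofReal.aemeasurable]
    calc _ ≤ ∫⁻ z, ENNReal.ofReal (G z * t ^ 3) ∂(gaussianReal 0 1) := by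
          refine lintegral_mono fun z => ?_
          set h := ℓ * z / Real.sqrt d with hh
          have hht : |h| = |ℓ * z| * t := by
            rw [hh, abs_div, abs_of_pos (by linarith : 0 < Real.sqrt d), ht]; rfl
          calc _ ≤ ∫⁻ x, (ENNReal.ofReal (|(V x - V (x + h)) / 2| ^ 3) +
                ENNReal.ofReal (|(V x - V (x + h)) / 2| ^ 3 *
                  Real.exp (2 * ((V x - V (x + h)) / 2)))) ∂(piMeasure V) := by
                refine lintegral_mono fun x => ?_
                rw [← ENNReal.ofReal_add (by positivity) (by positivity)]
                exact ENNReal.ofReal_le_ofReal (Rlog_bound _)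
            _ = _ := lintegral_add_left (by fun_prop) _
            _ ≤ ENNReal.ofReal (K * ((|h| ^ β) ^ 3 + |h| ^ 3)) +
                ENNReal.ofReal (K * ((|-h| ^ β) ^ 3 + |-h| ^ 3)) := by
                rw [reversal V hV hVint h]
                exact add_le_add (hKb h) (hKb (-h))
            _ = ENNReal.ofReal (2 * K * ((|h| ^ β) ^ 3 + |h| ^ 3)) := by
                rw [abs_neg, ← ENNReal.ofReal_add (by positivity) (by positivity)]
                congr 1; ring
            _ ≤ _ := by
                apply ENNReal.ofReal_le_ofReal
                have htb : t ^ β ≤ t := by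
                  simpa using Real.rpow_le_rpow_of_exponent_ge ht0 ht1 hβ.le
                rw [hht, Real.mul_rpow (abs_nonneg _) ht0.le, mul_pow, mul_pow]
                have : (t ^ β) ^ 3 ≤ t ^ 3 := by gcongr
                calc _ ≤ 2 * K * ((|ℓ * z| ^ β) ^ 3 * t ^ 3 + |ℓ * z| ^ 3 * t ^ 3) := by gcongr
                  _ = _ := by simp only [hG]; ring
      _ = ENNReal.ofReal (∫ z, G z * t ^ 3 ∂(gaussianReal 0 1)) :=
          (ofReal_integral_eq_lintegral_ofReal (hGi.mul_const _)
            (ae_of_all _ fun z => mul_nonneg (hG0 z) (by positivity))).symm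
      _ = _ := by rw [integral_mul_const]
  have hlim : Tendsto (fun d : ℕ => M * (Real.sqrt d)⁻¹) atTop (𝓝 0) := by
    have : Tendsto (fun d : ℕ => (Real.sqrt d)⁻¹) atTop (𝓝 0) :=
      tendsto_inv_atTop_zero.comp (Real.tendsto_sqrt_atTop.comp tendsto_natCast_atTop_atTop)
    simpa using this.const_mul M
  refine tendsto_of_tendsto_of_tendsto_of_le_of_le' tendsto_const_nhds hlim
    (Eventually.of_forall fun d =>
      mul_nonneg (Nat.cast_nonneg d) (integral_nonneg fun q => abs_nonneg _)) ?_
  filter_upwards [eventually_ge_atTop 1] with d hd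
  have hd0 : (0 : ℝ) < d := by exact_mod_cast hd
  have hs0 : 0 < Real.sqrt d := Real.sqrt_pos.mpr hd0
  calc _ ≤ (d : ℝ) * (M * ((Real.sqrt d)⁻¹) ^ 3) := by gcongr; exact hbound d hd
    _ = (Real.sqrt d) ^ 2 * (M * ((Real.sqrt d)⁻¹) ^ 3) := by rw [Real.sq_sqrt hd0.le]
    _ = _ := by field_simp
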